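/- Let Γ be a distance-regular graph with diameter D ≥ 3 and fix a base vertex x. For 1 ≤ h ≤ 3 and 1 ≤ i,j ≤ D, ⟨A_hE_i* − E_i*A_h, A_2E_j*A − AE_j*A_2⟩ = 2 k_2 p^2_{1h} (p^1_{ij} − p^2_{ij}); explicitly the factor p^2_{1h} equals c_2, a_2, b_2 for h = 1, 2, 3 respectively. -/

import Mathlib

open Matrix BigOperators

noncomputable section

structure DRG (X : Type) [Fintype X] [DecidableEq X] where
  G : SimpleGraph X
  D : ℕ
  hD : 3 ≤ D
  hconn : G.Connected
  hdiam_le : ∀ y z : X, G.dist y z ≤ D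
  hdiam : ∃ y z : X, G.dist y z = D
  p : ℕ → ℕ → ℕ → ℕ
  hp : ∀ h i j : ℕ, h ≤ D → i ≤ D → j ≤ D → ∀ y z : X, G.dist y z = h →
    Nat.card {w : X // G.dist y w = i ∧ G.dist z w = j} = p h i j

namespace DRG

variable {X : Type} [Fintype X] [DecidableEq X]

/-- The `i`-th distance matrix. -/
def A (Γ : DRG X) (i : ℕ) : Matrix X X ℂ :=
  Matrix.of fun y z => if Γ.G.dist y z = i then (1 : ℂ) else 0

/-- `c_i`, with the conventions `c_0 = 0` and `c_{D+1} = 1`. -/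
def cI (Γ : DRG X) (i : ℕ) : ℕ :=
  if i = 0 then 0 else if i ≤ Γ.D then Γ.p i 1 (i - 1) else 1

/-- `a_i`. -/
def aI (Γ : DRG X) (i : ℕ) : ℕ := Γ.p i 1 i

/-- `b_i`, with the convention `b_D = 0`. -/
def bI (Γ : DRG X) (i : ℕ) : ℕ := if i < Γ.D then Γ.p i 1 (i + 1) else 0

/-- `k_i`. -/
def kI (Γ : DRG X) (i : ℕ) : ℕ := Γ.p 0 i i

/-- The valency `k = b_0`. -/
def kval (Γ : DRG X) : ℕ := Γ.p 0 1 1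

/-- `Γ` is primitive: each distance-`i` graph is connected. -/
def Primitive (Γ : DRG X) : Prop :=
  ∀ i : ℕ, 1 ≤ i → i ≤ Γ.D →
    (SimpleGraph.fromRel fun y z => Γ.G.dist y z = i).Connected

/-- The Hermitean inner product `⟨R,S⟩ = tr(Rᵗ S̄)`. -/
def inn (R S : Matrix X X ℂ) : ℂ := (Rᵀ * S.map (starRingEnd ℂ)).trace

/-- The dual idempotent `E_i*` with respect to the base vertex `x`. -/
def Estar (Γ : DRG X) (x : X) (i : ℕ) : Matrix X X ℂ :=
  Matrix.diagonal fun y => if Γ.G.dist x y = i then (1 : ℂ) else 0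

/-- The polynomials `v_i`. -/
def vpoly (Γ : DRG X) : ℕ → Polynomial ℝ
  | 0 => 1
  | 1 => Polynomial.X
  | n + 2 =>
      ((Γ.cI (n + 2) : ℝ))⁻¹ •
        (Polynomial.X * vpoly Γ (n + 1) - (Γ.aI (n + 1) : ℝ) • vpoly Γ (n + 1)
          - (Γ.bI n : ℝ) • vpoly Γ n)

/-- The polynomials `u_i = v_i / k_i`. -/
def upoly (Γ : DRG X) (i : ℕ) : Polynomial ℝ := ((Γ.kI i : ℝ))⁻¹ • Γ.vpoly i

end DRG

/-- A system of primitive idempotents (with eigenvalues and Krein parameters) for `Γ`. -/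
structure IdemSys {X : Type} [Fintype X] [DecidableEq X] (Γ : DRG X) where
  E : Fin (Γ.D + 1) → Matrix X X ℂ
  θ : Fin (Γ.D + 1) → ℝ
  q : Fin (Γ.D + 1) → Fin (Γ.D + 1) → Fin (Γ.D + 1) → ℝ
  hE0 : E 0 = ((Fintype.card X : ℂ))⁻¹ • Matrix.of fun _ _ => (1 : ℂ)
  hEsum : ∑ i, E i = 1
  hEmul : ∀ i j, E i * E j = if i = j then E i else 0
  hEsymm : ∀ i, (E i)ᵀ = E i
  hEreal : ∀ i, (E i).map (starRingEnd ℂ) = E i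
  hEbasis : ∀ i, E i ∈ Submodule.span ℂ (Set.range fun n : Fin (Γ.D + 1) => Γ.A (n : ℕ))
  hEig : ∀ j, Γ.A 1 * E j = (θ j : ℂ) • E j
  hθ0 : θ 0 = (Γ.kval : ℝ)
  hθinj : Function.Injective θ
  hKrein : ∀ i j, Matrix.hadamard (E i) (E j) =
    ((Fintype.card X : ℂ))⁻¹ • ∑ h, (q h i j : ℂ) • E h

namespace IdemSys

variable {X : Type} [Fintype X] [DecidableEq X] {Γ : DRG X}

/-- `m_j`, the rank of `E_j`. -/
def m (I : IdemSys Γ) (j : Fin (Γ.D + 1)) : ℕ := (I.E j).rank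

/-- The dual distance matrix `A_i*` with respect to `x` and `E_i`. -/
def Astar (I : IdemSys Γ) (x : X) (i : Fin (Γ.D + 1)) : Matrix X X ℂ :=
  Matrix.diagonal fun y => (Fintype.card X : ℂ) * I.E i x y

end IdemSys

/-- `Γ` is Q-polynomial with respect to the ordering `E_{σ 0}, ..., E_{σ D}`. -/
def QPolyOrdering {X : Type} [Fintype X] [DecidableEq X] {Γ : DRG X} (I : IdemSys Γ)
    (σ : Equiv.Perm (Fin (Γ.D + 1))) : Prop :=
  ∀ h i j : Fin (Γ.D + 1),
    (((i : ℕ) + (j : ℕ) < (h : ℕ) ∨ (h : ℕ) + (j : ℕ) < (i : ℕ) ∨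
        (h : ℕ) + (i : ℕ) < (j : ℕ)) → I.q (σ h) (σ i) (σ j) = 0) ∧
    (((h : ℕ) = (i : ℕ) + (j : ℕ) ∨ (i : ℕ) = (h : ℕ) + (j : ℕ) ∨
        (j : ℕ) = (h : ℕ) + (i : ℕ)) → I.q (σ h) (σ i) (σ j) ≠ 0)

/-- The matrix `S^alt`. -/
def salt {n : ℕ} (S : Matrix (Fin (n + 1)) (Fin (n + 1)) ℂ) : Matrix (Fin n) (Fin n) ℂ :=
  Matrix.of fun i j => S i.succ j.succ - S 0 j.succ

/-- The matrix `(S^{-1})^alt`. -/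
def altInv {n : ℕ} (T : Matrix (Fin (n + 1)) (Fin (n + 1)) ℂ) : Matrix (Fin n) (Fin n) ℂ :=
  Matrix.of fun i j => T i.succ j.succ

/-- The `4D` matrices `A_2E_i*A − AE_i*A_2, A_3E_i* − E_i*A_3, A_2E_i* − E_i*A_2, AE_i* − E_i*A`. -/
def vecE {X : Type} [Fintype X] [DecidableEq X] (Γ : DRG X) (x : X)
    (a : Fin 4) (i : Fin Γ.D) : Matrix X X ℂ :=
  ![Γ.A 2 * Γ.Estar x ((i : ℕ) + 1) * Γ.A 1 - Γ.A 1 * Γ.Estar x ((i : ℕ) + 1) * Γ.A 2,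
    Γ.A 3 * Γ.Estar x ((i : ℕ) + 1) - Γ.Estar x ((i : ℕ) + 1) * Γ.A 3,
    Γ.A 2 * Γ.Estar x ((i : ℕ) + 1) - Γ.Estar x ((i : ℕ) + 1) * Γ.A 2,
    Γ.A 1 * Γ.Estar x ((i : ℕ) + 1) - Γ.Estar x ((i : ℕ) + 1) * Γ.A 1] a

/-- The `4D` matrices `A_2A_i*A − AA_i*A_2, A_3A_i* − A_i*A_3, A_2A_i* − A_i*A_2, AA_i* − A_i*A`. -/
def vecA {X : Type} [Fintype X] [DecidableEq X] {Γ : DRG X} (I : IdemSys Γ) (x : X)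
    (a : Fin 4) (i : Fin Γ.D) : Matrix X X ℂ :=
  ![Γ.A 2 * I.Astar x i.succ * Γ.A 1 - Γ.A 1 * I.Astar x i.succ * Γ.A 2,
    Γ.A 3 * I.Astar x i.succ - I.Astar x i.succ * Γ.A 3,
    Γ.A 2 * I.Astar x i.succ - I.Astar x i.succ * Γ.A 2,
    Γ.A 1 * I.Astar x i.succ - I.Astar x i.succ * Γ.A 1] a

namespace DRG

variable {X : Type} [Fintype X] [DecidableEq X] (Γ : DRG X)

theorem A_apply (i : ℕ) (y z : X) :
    Γ.A i y z = if Γ.G.dist y z = i then (1 : ℂ) else 0 := rfl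

theorem A_comm (i : ℕ) (y z : X) : Γ.A i y z = Γ.A i z y := by
  rw [A_apply, A_apply, SimpleGraph.dist_comm]

theorem A_mul_self_apply (i : ℕ) (y z : X) : Γ.A i y z * Γ.A i y z = Γ.A i y z := by
  rw [A_apply]; split_ifs <;> simp

theorem star_A_apply (i : ℕ) (y z : X) : (starRingEnd ℂ) (Γ.A i y z) = Γ.A i y z := by
  rw [A_apply]; split_ifs <;> simp

theorem Estar_eq_diagonal (x : X) (i : ℕ) : Γ.Estar x i = Matrix.diagonal (Γ.A i x) := rfl

theorem sum_A_mul_A_mul_A {h i j : ℕ} (hh : h ≤ Γ.D) (hi : i ≤ Γ.D) (hj : j ≤ Γ.D) (y z : X) :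
    ∑ w, Γ.A h y z * (Γ.A i y w * Γ.A j z w) = Γ.p h i j * Γ.A h y z := by
  by_cases hd : Γ.G.dist y z = h
  · have hcount := Γ.hp h i j hh hi hj y z hd
    rw [Nat.card_eq_fintype_card, Fintype.card_subtype] at hcount
    simp [A_apply, hd, ← hcount, ← ite_and, Finset.sum_boole, and_comm]
  · simp [A_apply, hd]

theorem sum_A {i : ℕ} (hi : i ≤ Γ.D) (y : X) : ∑ z, Γ.A i y z = Γ.kI i := by
  have h := Γ.sum_A_mul_A_mul_A (Nat.zero_le _) hi hi y y
  simpa [A_mul_self_apply, Γ.A_apply 0, kI] using h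

theorem sum_triangle {i j r : ℕ} (hi : i ≤ Γ.D) (hj : j ≤ Γ.D) (hr : r ≤ Γ.D) (x : X) :
    ∑ z, ∑ w, Γ.A i x z * (Γ.A j x w * Γ.A r z w) = Γ.kI i * Γ.p i j r := by
  simp_rw [Γ.sum_A_mul_A_mul_A hi hj hr, ← Finset.mul_sum, Γ.sum_A hi]
  ring

theorem kI_mul_p {i j r : ℕ} (hi : i ≤ Γ.D) (hj : j ≤ Γ.D) (hr : r ≤ Γ.D) :
    (Γ.kI i : ℂ) * Γ.p i j r = Γ.kI r * Γ.p r i j := by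
  have : Nonempty X := Γ.hconn.nonempty
  have hcard : (Fintype.card X : ℂ) ≠ 0 := by simp
  apply mul_left_cancel₀ hcard
  trans ∑ x, ∑ z, ∑ w, Γ.A i x z * (Γ.A j x w * Γ.A r z w)
  · simp [Γ.sum_triangle hi hj hr]
  · trans ∑ z, ∑ w, ∑ x, Γ.A r z w * (Γ.A i z x * Γ.A j w x)
    · rw [Finset.sum_comm]
      refine Finset.sum_congr rfl fun z _ => ?_
      rw [Finset.sum_comm]
      refine Finset.sum_congr rfl fun w _ => Finset.sum_congr rfl fun x _ => ?_
      rw [Γ.A_comm i x z, Γ.A_comm j x w]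
      ring
    · simp_rw [Γ.sum_A_mul_A_mul_A hr hi hj, ← Finset.mul_sum, Γ.sum_A hr]
      simp
      ring

theorem inn_eq_sum {X : Type} [Fintype X] (R S : Matrix X X ℂ) :
    inn R S = ∑ y, ∑ z, R y z * (starRingEnd ℂ) (S y z) := by
  simp only [inn, Matrix.trace, Matrix.diag, Matrix.mul_apply, Matrix.transpose_apply,
    Matrix.map_apply]
  exact Finset.sum_comm

theorem sum_pyramid {h i j r s : ℕ} (hh : h ≤ Γ.D) (hi : i ≤ Γ.D) (hj : j ≤ Γ.D)
    (hr : r ≤ Γ.D) (hs : s ≤ Γ.D) (x : X) :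
    ∑ y, ∑ z, ∑ w, Γ.A h y z * Γ.A i x z * (Γ.A r y w * Γ.A j x w * Γ.A s w z) =
      Γ.p s h r * (Γ.kI s * Γ.p s i j) := by
  rw [← Γ.kI_mul_p hi hj hs, ← Γ.sum_triangle hi hj hs x, Finset.mul_sum, Finset.sum_comm]
  refine Finset.sum_congr rfl fun z _ => ?_
  rw [Finset.sum_comm, Finset.mul_sum]
  refine Finset.sum_congr rfl fun w _ => ?_
  trans Γ.A i x z * Γ.A j x w * ∑ y, Γ.A s z w * (Γ.A h z y * Γ.A r w y)
  · rw [Finset.mul_sum]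
    refine Finset.sum_congr rfl fun y _ => ?_
    rw [Γ.A_comm h y z, Γ.A_comm r y w, Γ.A_comm s w z]
    ring
  · rw [Γ.sum_A_mul_A_mul_A hs hh hr]
    ring

theorem inn_A_Estar {h i j r s : ℕ} (hh : h ≤ Γ.D) (hi : i ≤ Γ.D) (hj : j ≤ Γ.D)
    (hr : r ≤ Γ.D) (hs : s ≤ Γ.D) (x : X) :
    inn (Γ.A h * Γ.Estar x i) (Γ.A r * Γ.Estar x j * Γ.A s) =
      Γ.p s h r * (Γ.kI s * Γ.p s i j) := by
  rw [← Γ.sum_pyramid hh hi hj hr hs x, inn_eq_sum]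
  simp_rw [Estar_eq_diagonal, Matrix.mul_apply (M := Γ.A r * _), Matrix.mul_diagonal, map_sum,
    map_mul, star_A_apply, Finset.mul_sum]

theorem transpose_A (i : ℕ) : (Γ.A i)ᵀ = Γ.A i := by
  ext y z; exact Γ.A_comm i z y

theorem transpose_Estar (x : X) (i : ℕ) : (Γ.Estar x i)ᵀ = Γ.Estar x i :=
  Matrix.diagonal_transpose _

theorem inn_transpose {X : Type} [Fintype X] (R S : Matrix X X ℂ) : inn Rᵀ Sᵀ = inn R S := by
  simp only [inn_eq_sum, Matrix.transpose_apply]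
  exact Finset.sum_comm

theorem inn_sub_sub {X : Type} [Fintype X] (P P' Q Q' : Matrix X X ℂ) :
    inn (P - P') (Q - Q') = inn P Q - inn P Q' - (inn P' Q - inn P' Q') := by
  simp only [inn_eq_sum, Matrix.sub_apply, map_sub, sub_mul, mul_sub, Finset.sum_sub_distrib]
  ring

theorem inn_Estar_A {h i j r s : ℕ} (hh : h ≤ Γ.D) (hi : i ≤ Γ.D) (hj : j ≤ Γ.D)
    (hr : r ≤ Γ.D) (hs : s ≤ Γ.D) (x : X) :
    inn (Γ.Estar x i * Γ.A h) (Γ.A s * Γ.Estar x j * Γ.A r) =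
      Γ.p s h r * (Γ.kI s * Γ.p s i j) := by
  rw [← Γ.inn_A_Estar hh hi hj hr hs x, ← inn_transpose]
  simp only [Matrix.transpose_mul, transpose_A, transpose_Estar, Matrix.mul_assoc]

/-- The two indices of an intersection number may be swapped, after weighting by `k_s`. -/
theorem kI_mul_p_comm {s i j : ℕ} (hs : s ≤ Γ.D) (hi : i ≤ Γ.D) (hj : j ≤ Γ.D) :
    (Γ.kI s : ℂ) * Γ.p s i j = Γ.kI s * Γ.p s j i := by
  obtain ⟨x⟩ : Nonempty X := Γ.hconn.nonempty
  rw [← Γ.kI_mul_p hi hj hs, ← Γ.kI_mul_p hj hi hs, ← Γ.sum_triangle hi hj hs x,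
    ← Γ.sum_triangle hj hi hs x, Finset.sum_comm]
  refine Finset.sum_congr rfl fun z _ => Finset.sum_congr rfl fun w _ => ?_
  rw [Γ.A_comm s z w]
  ring

end DRG

/-- `⟨A_hE_i* − E_i*A_h, A_2E_j*A − AE_j*A_2⟩ = 2k_2 p^2_{1h}(p^1_{ij} − p^2_{ij})`
for `1 ≤ h ≤ 3`, where `p^2_{11} = c_2`, `p^2_{12} = a_2`, `p^2_{13} = b_2`. -/
theorem stmt_10 {X : Type} [Fintype X] [DecidableEq X] (Γ : DRG X) (x : X) :
    (∀ h : ℕ, 1 ≤ h → h ≤ 3 → ∀ i j : ℕ, 1 ≤ i → i ≤ Γ.D → 1 ≤ j → j ≤ Γ.D →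
      DRG.inn (Γ.A h * Γ.Estar x i - Γ.Estar x i * Γ.A h)
          (Γ.A 2 * Γ.Estar x j * Γ.A 1 - Γ.A 1 * Γ.Estar x j * Γ.A 2) =
        2 * (Γ.kI 2 : ℂ) * (Γ.p 2 1 h : ℂ) * ((Γ.p 1 i j : ℂ) - (Γ.p 2 i j : ℂ))) ∧
    Γ.p 2 1 1 = Γ.cI 2 ∧ Γ.p 2 1 2 = Γ.aI 2 ∧ Γ.p 2 1 3 = Γ.bI 2 := by
  refine ⟨fun h h1 h3 i j _ hi _ hj => ?_, ?_, rfl, ?_⟩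
  · have hD := Γ.hD
    have hh : h ≤ Γ.D := by omega
    have d1 : 1 ≤ Γ.D := by omega
    have d2 : 2 ≤ Γ.D := by omega
    rw [DRG.inn_sub_sub, Γ.inn_A_Estar hh hi hj d2 d1, Γ.inn_A_Estar hh hi hj d1 d2,
      Γ.inn_Estar_A hh hi hj d1 d2, Γ.inn_Estar_A hh hi hj d2 d1]
    linear_combination (2 * (Γ.p 1 i j : ℂ)) * Γ.kI_mul_p d1 hh d2 -
      2 * (Γ.p 2 i j : ℂ) * Γ.kI_mul_p_comm d2 hh d1
  · have := Γ.hD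
    simp [DRG.cI, show 2 ≤ Γ.D by omega]
  · have := Γ.hD
    simp [DRG.bI, show 2 < Γ.D by omega]
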